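/- arXiv:2410.03282 — 4 statements merged into one kernel-verified Lean document; each statement's English description precedes it below -/
import Mathlib

section
/- Let f : ℝ × ℝ^d → ℝ be measurable such that for every x the map t ↦ f(t,x) is differentiable with derivative ∂_t f(t,x), for every t the function x ↦ e^{-f(t,x)} is Lebesgue integrable with Z(t) := ∫_{ℝ^d} e^{-f(t,x)} dx > 0, and suppose there is a Lebesgue-integrable function g : ℝ^d → ℝ with |∂_t f(t,x)| e^{-f(t,x)} ≤ g(x) for all t in an interval I and all x. Then for ρ(t,x) := e^{-f(t,x)}/Z(t) and every t in the interior of I and every x ∈ ℝ^d, the map t ↦ ρ(t,x) is differentiable with derivative ∂_t ρ(t,x) = −(∂_t f(t,x) − ∫_{ℝ^d} ∂_t f(t,y) ρ(t,y) dy) · ρ(t,x). -/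
open MeasureTheory Real

/-- The pointwise derivative in a real parameter of a family of measurable functions is
measurable. -/
theorem measurable_of_hasDerivAt_param {α : Type*} [MeasurableSpace α] {f : ℝ → α → ℝ}
    {f' : α → ℝ} {t : ℝ} (hf : ∀ s, Measurable (f s))
    (hderiv : ∀ x, HasDerivAt (fun s => f s x) (f' x) t) : Measurable f' := by
  refine measurable_of_tendsto_metrizable' (nhdsWithin (0 : ℝ) {0}ᶜ)
    (f := fun h x => h⁻¹ • (f (t + h) x - f t x))
    (fun h => ((hf (t + h)).sub (hf t)).const_smul h⁻¹) ?_
  rw [tendsto_pi_nhds]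
  exact fun x => (hasDerivAt_iff_tendsto_slope_zero.1 (hderiv x))

/-- A Boltzmann curve `ρ_t = e^{-f_t}/Z_t` satisfies the Fisher-Rao flow equation
`∂_t ρ_t = -(∂_t f_t - E_{ρ_t}[∂_t f_t]) ρ_t` at interior points of the interval `I`,
under a domination hypothesis allowing differentiation under the integral sign. -/
theorem fisher_rao_flow_of_boltzmann_curve
    (d : ℕ) (f f' : ℝ → EuclideanSpace ℝ (Fin d) → ℝ)
    (hf_meas : Measurable (Function.uncurry f))
    (hderiv : ∀ t x, HasDerivAt (fun s => f s x) (f' t x) t)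
    (hint : ∀ t, Integrable (fun x => Real.exp (-(f t x))))
    (Z : ℝ → ℝ) (hZ : ∀ t, Z t = ∫ x, Real.exp (-(f t x)))
    (hZpos : ∀ t, 0 < Z t)
    (I : Set ℝ) (hI : I.OrdConnected)
    (g : EuclideanSpace ℝ (Fin d) → ℝ) (hg : Integrable g)
    (hdom : ∀ t ∈ I, ∀ x, |f' t x| * Real.exp (-(f t x)) ≤ g x)
    (ρ : ℝ → EuclideanSpace ℝ (Fin d) → ℝ)
    (hρ : ∀ t x, ρ t x = Real.exp (-(f t x)) / Z t) :
    ∀ t ∈ interior I, ∀ x,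
      HasDerivAt (fun s => ρ s x)
        (-(f' t x - ∫ y, f' t y * ρ t y) * ρ t x) t := by
  intro t ht x
  have hft : ∀ s, Measurable (f s) := fun s => hf_meas.of_uncurry_left
  have hexp : ∀ s y, HasDerivAt (fun r => Real.exp (-(f r y)))
      (Real.exp (-(f s y)) * -(f' s y)) s := fun s y => (hderiv s y).neg.exp
  have hZderiv : HasDerivAt Z (∫ y, Real.exp (-(f t y)) * -(f' t y)) t := by
    rw [funext hZ]
    refine (hasDerivAt_integral_of_dominated_loc_of_deriv_le
      (F' := fun s y => Real.exp (-(f s y)) * -(f' s y))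
      (mem_interior_iff_mem_nhds.1 ht)
      (Filter.Eventually.of_forall fun s => (hint s).aestronglyMeasurable) (hint t) ?_
      (Filter.Eventually.of_forall fun y s hs => ?_) hg
      (Filter.Eventually.of_forall fun y s _ => hexp s y)).2
    · exact ((hft t).neg.exp.mul
        (measurable_of_hasDerivAt_param hft (hderiv t)).neg).aestronglyMeasurable
    · rw [norm_mul, norm_neg, Real.norm_eq_abs, Real.norm_eq_abs, Real.abs_exp, mul_comm]
      exact hdom s hs y
  have hne : Z t ≠ 0 := (hZpos t).ne'
  have hmean : ∫ y, f' t y * ρ t y = -(∫ y, Real.exp (-(f t y)) * -(f' t y)) / Z t := by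
    rw [← integral_neg, ← integral_div]
    congr 1 with y
    rw [hρ]
    ring
  have hρderiv := (hexp t x).div hZderiv hne
  rw [hmean, hρ t x, funext fun s => hρ s x]
  refine hρderiv.congr_deriv ?_
  field_simp
  ring
end

section
/- Let d ≥ 1 and V : ℝ^d → ℝ be differentiable, and assume there exist η > 0 and R̃ ≥ 0 such that ⟨x, ∇V(x)⟩ ≥ η‖x‖ for all x with ‖x‖ > R̃. Set γ := η/2, R := max{2d/η, R̃}, and W(x) := e^{γ‖x‖}. Then for every x with ‖x‖ > R, it holds ΔW(x) − ⟨∇V(x), ∇W(x)⟩ ≤ −(η²/(4d)) W(x). -/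
open MeasureTheory Real
open scoped RealInnerProductSpace

section NormDerivatives

variable {E : Type*} [NormedAddCommGroup E] [InnerProductSpace ℝ E]

theorem hasFDerivAt_norm_of_ne_zero {x : E} (hx : x ≠ 0) :
    HasFDerivAt (fun y : E => ‖y‖) (‖x‖⁻¹ • innerSL ℝ x) x := by
  have h := (hasStrictFDerivAt_norm_sq x).hasFDerivAt.sqrt (pow_ne_zero 2 (norm_ne_zero_iff.2 hx))
  simp only [Real.sqrt_sq (norm_nonneg _)] at h
  convert h using 1
  ext v
  simp
  field_simp

theorem hasFDerivAt_exp_mul_norm (γ : ℝ) {x : E} (hx : x ≠ 0) :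
    HasFDerivAt (fun y : E => Real.exp (γ * ‖y‖))
      ((γ * Real.exp (γ * ‖x‖) * ‖x‖⁻¹) • innerSL ℝ x) x := by
  convert ((hasFDerivAt_norm_of_ne_zero hx).const_mul γ).exp using 1
  simp only [smul_smul]
  ring_nf

theorem fderiv_fderiv_exp_mul_norm (γ : ℝ) {x : E} (hx : x ≠ 0) (v : E) :
    fderiv ℝ (fun y => fderiv ℝ (fun z : E => Real.exp (γ * ‖z‖)) y v) x v =
      Real.exp (γ * ‖x‖) *
        (γ / ‖x‖ * ‖v‖ ^ 2 + (γ ^ 2 / ‖x‖ ^ 2 - γ / ‖x‖ ^ 3) * ⟪x, v⟫ ^ 2) := by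
  have hx' : ‖x‖ ≠ 0 := norm_ne_zero_iff.2 hx
  have heq : (fun y => fderiv ℝ (fun z : E => Real.exp (γ * ‖z‖)) y v) =ᶠ[nhds x]
      fun y => γ * Real.exp (γ * ‖y‖) * ‖y‖⁻¹ * ⟪v, y⟫ := by
    filter_upwards [isOpen_ne.mem_nhds hx] with y hy
    rw [(hasFDerivAt_exp_mul_norm γ hy).fderiv]
    simp [real_inner_comm]
  have hinv : HasFDerivAt (fun y : E => ‖y‖⁻¹) _ x :=
    (hasDerivAt_inv hx').comp_hasFDerivAt x (hasFDerivAt_norm_of_ne_zero hx)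
  have h := (((hasFDerivAt_exp_mul_norm γ hx).const_mul γ).mul hinv).mul
    (innerSL ℝ v).hasFDerivAt
  rw [heq.fderiv_eq]
  refine (congrArg (fun L : E →L[ℝ] ℝ => L v) h.fderiv).trans ?_
  simp [real_inner_comm]
  field_simp
  ring

theorem gradient_exp_mul_norm [CompleteSpace E] (γ : ℝ) {x : E} (hx : x ≠ 0) :
    gradient (fun y : E => Real.exp (γ * ‖y‖)) x = (γ * Real.exp (γ * ‖x‖) * ‖x‖⁻¹) • x := by
  refine HasGradientAt.gradient ?_
  rw [hasGradientAt_iff_hasFDerivAt]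
  refine (hasFDerivAt_exp_mul_norm γ hx).congr_fderiv ?_
  ext v
  simp

end NormDerivatives

theorem sum_fderiv_fderiv_exp_mul_norm {d : ℕ} (γ : ℝ) {x : EuclideanSpace ℝ (Fin d)}
    (hx : x ≠ 0) :
    ∑ i, fderiv ℝ (fun y => fderiv ℝ (fun z : EuclideanSpace ℝ (Fin d) => Real.exp (γ * ‖z‖)) y
        (EuclideanSpace.single i 1)) x (EuclideanSpace.single i 1) =
      Real.exp (γ * ‖x‖) * (γ ^ 2 + γ * (d - 1) / ‖x‖) := by
  have hx' : ‖x‖ ≠ 0 := norm_ne_zero_iff.2 hx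
  simp only [fderiv_fderiv_exp_mul_norm γ hx, ← Finset.mul_sum, Finset.sum_add_distrib]
  have hsum : ∑ i, ⟪x, EuclideanSpace.single i (1 : ℝ)⟫ ^ 2 = ‖x‖ ^ 2 := by
    simp [EuclideanSpace.norm_sq_eq, EuclideanSpace.inner_single_right]
  rw [hsum]
  simp
  field_simp
  ring

/-- Under the drift condition `⟨x, ∇V(x)⟩ ≥ η‖x‖` for `‖x‖ > R̃`, the Lyapunov function
`W(x) = e^{(η/2)‖x‖}` satisfies `ΔW(x) - ⟨∇V(x), ∇W(x)⟩ ≤ -(η²/(4d)) W(x)` for all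
`‖x‖ > R`, where `R = max{2d/η, R̃}`. -/
theorem lyapunov_drift_inequality
    (d : ℕ) (hd : 1 ≤ d) (V : EuclideanSpace ℝ (Fin d) → ℝ)
    (hV : Differentiable ℝ V)
    (η Rtilde : ℝ) (hη : 0 < η) (hRtilde : 0 ≤ Rtilde)
    (hdrift : ∀ x : EuclideanSpace ℝ (Fin d), Rtilde < ‖x‖ →
      η * ‖x‖ ≤ ⟪x, gradient V x⟫)
    (γ R : ℝ) (hγ : γ = η / 2) (hR : R = max (2 * d / η) Rtilde)
    (W : EuclideanSpace ℝ (Fin d) → ℝ) (hW : ∀ x, W x = Real.exp (γ * ‖x‖)) :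
    ∀ x : EuclideanSpace ℝ (Fin d), R < ‖x‖ →
      (∑ i, fderiv ℝ (fun y => fderiv ℝ W y (EuclideanSpace.single i 1)) x
          (EuclideanSpace.single i 1))
        - ⟪gradient V x, gradient W x⟫ ≤ -(η ^ 2 / (4 * d)) * W x := by
  intro x hx
  obtain rfl : W = fun x => Real.exp (γ * ‖x‖) := funext hW
  subst hγ hR
  obtain ⟨hxη, hxR⟩ := max_lt_iff.1 hx
  have hr : 0 < ‖x‖ := hRtilde.trans_lt hxR
  have hx0 : x ≠ 0 := norm_pos_iff.1 hr
  have hd0 : (1 : ℝ) ≤ d := by exact_mod_cast hd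
  have hgrad : η ^ 2 / 2 ≤ η / 2 * ‖x‖⁻¹ * ⟪gradient V x, x⟫ := by
    rw [real_inner_comm]
    calc η ^ 2 / 2 = η / 2 * ‖x‖⁻¹ * (η * ‖x‖) := by field_simp
      _ ≤ _ := by gcongr; exact hdrift x hxR
  have hlap : η / 2 * (d - 1) / ‖x‖ ≤ η ^ 2 / 4 - η ^ 2 / (4 * d) := by
    calc η / 2 * (d - 1) / ‖x‖ ≤ η / 2 * (d - 1) / (2 * d / η) := by
          have : 0 ≤ (d : ℝ) - 1 := by linarith
          gcongr
      _ = _ := by field_simp; ring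
  rw [sum_fderiv_fderiv_exp_mul_norm _ hx0, gradient_exp_mul_norm _ hx0, real_inner_smul_right]
  calc _ = Real.exp (η / 2 * ‖x‖) * ((η / 2) ^ 2 + η / 2 * (d - 1) / ‖x‖
          - η / 2 * ‖x‖⁻¹ * ⟪gradient V x, x⟫) := by ring
    _ ≤ Real.exp (η / 2 * ‖x‖) * -(η ^ 2 / (4 * d)) := by
          gcongr
          linarith
    _ = _ := mul_comm _ _
end

section
/- Let f_0, f_1 : ℝ^d → ℝ be continuous, bounded below by some γ ∈ ℝ, and assume there exist α > 0 and R > 0 such that f_i(x) ≥ α‖x‖ for all ‖x‖ > R, and additionally M > 0 and k ∈ ℕ such that |f_i(x)| ≤ M‖x‖^k for all ‖x‖ > R, for i = 0,1. For t ∈ [0,1] let V_t := (1−t) f_0 + t f_1, Z_t := ∫_{ℝ^d} e^{−V_t(x)} dx, and ρ_t the probability measure with density Z_t^{−1} e^{−V_t}. Then there exists a constant C > 0, independent of t, such that for all t ∈ [0,1]: ∫_{ℝ^d} (f_0 − f_1)² dρ_t ≤ C and |∫_{ℝ^d} (f_0 − f_1) dρ_t| ≤ C. -/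
open MeasureTheory Real

/-- Polynomials in `1 + ‖x‖` are integrable against an exponentially decaying weight. -/
theorem integrable_one_add_norm_pow_mul_exp_neg {E : Type*} [NormedAddCommGroup E]
    [NormedSpace ℝ E] [FiniteDimensional ℝ E] [MeasurableSpace E] [BorelSpace E]
    (μ : Measure E) [μ.IsAddHaarMeasure] {a : ℝ} (ha : 0 < a) (m : ℕ) :
    Integrable (fun x : E => (1 + ‖x‖) ^ m * Real.exp (-(a * ‖x‖))) μ := by
  set n : ℕ := Module.finrank ℝ E + 1
  have hdom : Integrable (fun x : E => (Real.exp a * ((m + n).factorial / a ^ (m + n))) *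
      (1 + ‖x‖) ^ (-(n : ℝ))) μ :=
    (integrable_one_add_norm (by simp [n])).const_mul _
  refine hdom.mono' (by fun_prop) (.of_forall fun x => ?_)
  have hs : 0 < 1 + ‖x‖ := by positivity
  have hexp := Real.pow_div_factorial_le_exp (a * (1 + ‖x‖)) (by positivity) (m + n)
  rw [Real.norm_of_nonneg (by positivity), Real.rpow_neg hs.le, Real.rpow_natCast]
  have hsplit : Real.exp (-(a * ‖x‖)) = Real.exp a * (Real.exp (a * (1 + ‖x‖)))⁻¹ := by
    rw [← Real.exp_neg, ← Real.exp_add]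
    congr 1
    ring
  have hinv := inv_anti₀ (by positivity) hexp
  calc (1 + ‖x‖) ^ m * Real.exp (-(a * ‖x‖))
      ≤ (1 + ‖x‖) ^ m * (Real.exp a * ((a * (1 + ‖x‖)) ^ (m + n) / (m + n).factorial)⁻¹) := by
        rw [hsplit]
        gcongr
    _ = _ := by
        rw [mul_pow, pow_add (1 + ‖x‖)]
        field_simp

/-- A continuous function of polynomial growth outside a ball has polynomial growth globally. -/
theorem Continuous.exists_abs_le_mul_one_add_norm_pow {E : Type*} [NormedAddCommGroup E]
    [ProperSpace E] {f : E → ℝ} (hf : Continuous f) {R M : ℝ} {k : ℕ}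
    (h : ∀ x, R < ‖x‖ → |f x| ≤ M * ‖x‖ ^ k) :
    ∃ A, ∀ x, |f x| ≤ A * (1 + ‖x‖) ^ k := by
  obtain ⟨B, hB⟩ := (isCompact_closedBall (0 : E) R).exists_bound_of_continuousOn hf.continuousOn
  refine ⟨max |B| |M|, fun x => ?_⟩
  rcases lt_or_ge R ‖x‖ with hx | hx
  · calc |f x| ≤ M * ‖x‖ ^ k := h x hx
      _ ≤ max |B| |M| * (1 + ‖x‖) ^ k := by
        gcongr
        · exact (le_abs_self M).trans (le_max_right _ _)
        · linarith
  · calc |f x| ≤ B := hB x (by simpa using hx)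
      _ ≤ max |B| |M| * 1 := by
        rw [mul_one]
        exact (le_abs_self B).trans (le_max_left _ _)
      _ ≤ max |B| |M| * (1 + ‖x‖) ^ k := by
        gcongr
        exact one_le_pow₀ (by simp)

/-- A function bounded below and of linear growth outside a ball dominates, globally, a linear
function of the norm. -/
theorem mul_norm_sub_le_of_linear_growth {E : Type*} [NormedAddCommGroup E] {f : E → ℝ}
    {γ a R : ℝ} (ha : 0 ≤ a) (hR : 0 ≤ R) (hγ : ∀ x, γ ≤ f x)
    (h : ∀ x, R < ‖x‖ → a * ‖x‖ ≤ f x) (x : E) :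
    a * ‖x‖ - (a * R + |γ|) ≤ f x := by
  rcases lt_or_ge R ‖x‖ with hx | hx
  · have := h x hx
    have : 0 ≤ a * R + |γ| := by positivity
    linarith
  · have := mul_le_mul_of_nonneg_left hx ha
    linarith [hγ x, neg_abs_le γ]

/-- Uniform-in-time `L²` and `L¹` bounds on the Fisher-Rao rate `f_0 - f_1` along the
linear interpolation: for continuous energies `f_0, f_1` bounded below by `γ`, with
linear growth and polynomial growth outside a ball, there is `C > 0` independent of
`t ∈ [0,1]` with `∫ (f_0 - f_1)² dρ_t ≤ C` and `|∫ (f_0 - f_1) dρ_t| ≤ C`. -/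
theorem uniform_L2_bound_of_fisher_rao_rate
    (d : ℕ) (f₀ f₁ : EuclideanSpace ℝ (Fin d) → ℝ)
    (hf₀ : Continuous f₀) (hf₁ : Continuous f₁)
    (γ : ℝ) (hbdd₀ : ∀ x, γ ≤ f₀ x) (hbdd₁ : ∀ x, γ ≤ f₁ x)
    (α R : ℝ) (hα : 0 < α) (hR : 0 < R)
    (hgrowth : ∀ x : EuclideanSpace ℝ (Fin d), R < ‖x‖ →
      α * ‖x‖ ≤ f₀ x ∧ α * ‖x‖ ≤ f₁ x)
    (M : ℝ) (k : ℕ) (hM : 0 < M)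
    (hpoly : ∀ x : EuclideanSpace ℝ (Fin d), R < ‖x‖ →
      |f₀ x| ≤ M * ‖x‖ ^ k ∧ |f₁ x| ≤ M * ‖x‖ ^ k)
    (V : ℝ → EuclideanSpace ℝ (Fin d) → ℝ)
    (hV : ∀ t x, V t x = (1 - t) * f₀ x + t * f₁ x)
    (Z : ℝ → ℝ) (hZ : ∀ t, Z t = ∫ x, Real.exp (-(V t x)))
    (ρ : ℝ → Measure (EuclideanSpace ℝ (Fin d)))
    (hρ : ∀ t, ρ t = volume.withDensity fun x =>
      ENNReal.ofReal ((Z t)⁻¹ * Real.exp (-(V t x)))) :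
    ∃ C > 0, ∀ t ∈ Set.Icc (0:ℝ) 1,
      (∫ x, (f₀ x - f₁ x)^2 ∂(ρ t)) ≤ C ∧
      |∫ x, (f₀ x - f₁ x) ∂(ρ t)| ≤ C := by
  obtain ⟨A₀, hA₀⟩ := hf₀.exists_abs_le_mul_one_add_norm_pow fun x hx => (hpoly x hx).1
  obtain ⟨A₁, hA₁⟩ := hf₁.exists_abs_le_mul_one_add_norm_pow fun x hx => (hpoly x hx).2
  set K := α * R + |γ|
  have hlow₀ : ∀ x, α * ‖x‖ - K ≤ f₀ x :=
    mul_norm_sub_le_of_linear_growth hα.le hR.le hbdd₀ fun x hx => (hgrowth x hx).1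
  have hlow₁ : ∀ x, α * ‖x‖ - K ≤ f₁ x :=
    mul_norm_sub_le_of_linear_growth hα.le hR.le hbdd₁ fun x hx => (hgrowth x hx).2
  set P := 1 + (A₀ + A₁) ^ 2
  have hP : 0 < P := by positivity
  have hsq : ∀ x, 1 + (f₀ x - f₁ x) ^ 2 ≤ P * (1 + ‖x‖) ^ (2 * k) := fun x => by
    have hdiff : |f₀ x - f₁ x| ≤ (A₀ + A₁) * (1 + ‖x‖) ^ k :=
      (abs_sub _ _).trans (by linarith [hA₀ x, hA₁ x])
    have hone : 1 ≤ (1 + ‖x‖) ^ (2 * k) := one_le_pow₀ (by simp)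
    have hpow := pow_le_pow_left₀ (abs_nonneg _) hdiff 2
    rw [sq_abs, mul_pow, ← pow_mul, mul_comm k] at hpow
    linarith
  have hVlow : ∀ t ∈ Set.Icc (0 : ℝ) 1, ∀ x,
      Real.exp (-(V t x)) ≤ Real.exp K * Real.exp (-(α * ‖x‖)) := fun t ht x => by
    rw [← Real.exp_add, Real.exp_le_exp, hV]
    nlinarith [mul_le_mul_of_nonneg_left (hlow₀ x) (sub_nonneg.2 ht.2),
      mul_le_mul_of_nonneg_left (hlow₁ x) ht.1]
  have hVup : ∀ t ∈ Set.Icc (0 : ℝ) 1, ∀ x,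
      Real.exp (-(|f₀ x| + |f₁ x|)) ≤ Real.exp (-(V t x)) := fun t ht x => by
    rw [Real.exp_le_exp, hV]
    nlinarith [mul_le_mul_of_nonneg_left (le_abs_self (f₀ x)) (sub_nonneg.2 ht.2),
      mul_le_mul_of_nonneg_left (le_abs_self (f₁ x)) ht.1,
      mul_nonneg ht.1 (abs_nonneg (f₀ x)), mul_nonneg (sub_nonneg.2 ht.2) (abs_nonneg (f₁ x))]
  have hVcont : ∀ t, Continuous (V t) := fun t => by
    rw [show V t = _ from funext (hV t)]
    fun_prop
  have hdecay : Integrable fun x : EuclideanSpace ℝ (Fin d) =>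
      Real.exp K * Real.exp (-(α * ‖x‖)) := by
    simpa using (integrable_one_add_norm_pow_mul_exp_neg volume hα 0).const_mul (Real.exp K)
  have hVint : ∀ t ∈ Set.Icc (0 : ℝ) 1, Integrable fun x => Real.exp (-(V t x)) := fun t ht =>
    hdecay.mono' (by have := hVcont t; fun_prop) (.of_forall fun x => by
      rw [Real.norm_of_nonneg (by positivity)]
      exact hVlow t ht x)
  have hgint : Integrable fun x => Real.exp (-(|f₀ x| + |f₁ x|)) :=
    (hVint 0 (by simp)).mono' (by fun_prop) (.of_forall fun x => by
      rw [Real.norm_of_nonneg (by positivity)]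
      exact hVup 0 (by simp) x)
  set z := ∫ x, Real.exp (-(|f₀ x| + |f₁ x|))
  have hz : 0 < z := integral_exp_pos hgint
  have hzZ : ∀ t ∈ Set.Icc (0 : ℝ) 1, z ≤ Z t := fun t ht => by
    rw [hZ]
    exact integral_mono hgint (hVint t ht) (hVup t ht)
  set G : EuclideanSpace ℝ (Fin d) → ℝ := fun x =>
    z⁻¹ * Real.exp K * P * ((1 + ‖x‖) ^ (2 * k) * Real.exp (-(α * ‖x‖)))
  have hG : Integrable G := (integrable_one_add_norm_pow_mul_exp_neg volume hα (2 * k)).const_mul _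
  have hGnonneg : 0 ≤ ∫ x, G x := integral_nonneg fun x => by positivity
  have key : ∀ t ∈ Set.Icc (0 : ℝ) 1, ∀ φ : EuclideanSpace ℝ (Fin d) → ℝ,
      (∀ x, |φ x| ≤ 1 + (f₀ x - f₁ x) ^ 2) → |∫ x, φ x ∂(ρ t)| ≤ ∫ x, G x := by
    intro t ht φ hφ
    have hZpos : 0 < Z t := hz.trans_le (hzZ t ht)
    rw [hρ, integral_withDensity_eq_integral_toReal_smul
      (by have := hVcont t; fun_prop) (.of_forall fun x => ENNReal.ofReal_lt_top), ← Real.norm_eq_abs]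
    refine norm_integral_le_of_norm_le hG (.of_forall fun x => ?_)
    rw [ENNReal.toReal_ofReal (by positivity), smul_eq_mul, norm_mul,
      Real.norm_of_nonneg (by positivity), Real.norm_eq_abs]
    calc (Z t)⁻¹ * Real.exp (-(V t x)) * |φ x|
        ≤ z⁻¹ * (Real.exp K * Real.exp (-(α * ‖x‖))) * (P * (1 + ‖x‖) ^ (2 * k)) := by
          gcongr
          · exact hzZ t ht
          · exact hVlow t ht x
          · exact (hφ x).trans (hsq x)
      _ = G x := by simp only [G]; ring
  refine ⟨(∫ x, G x) + 1, by positivity, fun t ht => ⟨?_, ?_⟩⟩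
  · have h := key t ht (fun x => (f₀ x - f₁ x) ^ 2) fun x => by
      rw [abs_of_nonneg (sq_nonneg _)]
      linarith
    linarith [le_abs_self (∫ x, (f₀ x - f₁ x) ^ 2 ∂(ρ t))]
  · have h := key t ht (fun x => f₀ x - f₁ x) fun x => by
      nlinarith [sq_abs (f₀ x - f₁ x), sq_nonneg (|f₀ x - f₁ x| - 1),
        sq_nonneg (f₀ x - f₁ x)]
    linarith
end

section
/- Let m > 0 and t ∈ [0,1] with t ≠ 1/3. Then ∫_ℝ e^{−(1−t)|x| − 2t·min{|x|, |x−m|}} dx = 2/(1+t) − (1/(1+t) + 1/(3t−1)) e^{−m(1+t)/2} + (1/(1+t) + 1/(3t−1)) e^{−m(1−t)}. -/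
open MeasureTheory Real

/-- The integral of `exp (a * x + b)` over a bounded interval. -/
lemma intervalIntegral_exp_mul_add {a : ℝ} (ha : a ≠ 0) (b u v : ℝ) :
    ∫ x in u..v, exp (a * x + b) = (exp (a * v + b) - exp (a * u + b)) / a := by
  rw [intervalIntegral.integral_comp_mul_add (fun x => exp x) ha, integral_exp, smul_eq_mul]
  ring

/-- The normalization constant of the linear interpolation between the Laplacian energy
`f_0(x) = |x|` and the bimodal Laplacian-type energy `f_1(x) = 2 min{|x|, |x-m|}`:
`∫ e^{-(1-t)|x| - 2t min{|x|,|x-m|}} dx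
  = 2/(1+t) - (1/(1+t) + 1/(3t-1)) e^{-m(1+t)/2} + (1/(1+t) + 1/(3t-1)) e^{-m(1-t)}`. -/
theorem normalization_constant_teleportation_example
    (m t : ℝ) (hm : 0 < m) (ht : t ∈ Set.Icc (0:ℝ) 1) (ht3 : t ≠ 1/3) :
    ∫ x : ℝ, Real.exp (-((1 - t) * |x| + 2 * t * min |x| |x - m|)) =
      2 / (1 + t) - (1 / (1 + t) + 1 / (3 * t - 1)) * Real.exp (-m * (1 + t) / 2)
        + (1 / (1 + t) + 1 / (3 * t - 1)) * Real.exp (-m * (1 - t)) := by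
  obtain ⟨ht0, -⟩ := ht
  have ha : 0 < 1 + t := by linarith
  have hb : 3 * t - 1 ≠ 0 := fun h => ht3 (by linarith)
  set f : ℝ → ℝ := fun x => exp (-((1 - t) * |x| + 2 * t * min |x| |x - m|)) with hf
  have hcont : Continuous f := by fun_prop
  have f_left : Set.EqOn f (fun x => exp ((1 + t) * x)) (Set.Iic 0) := by
    intro x (hx : x ≤ 0)
    simp only [hf]
    rw [abs_of_nonpos hx, abs_of_nonpos (by linarith), min_eq_left (by linarith)]
    ring_nf
  have f_near : Set.EqOn f (fun x => exp (-(1 + t) * x + 0)) (Set.uIcc 0 (m / 2)) := by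
    rw [Set.uIcc_of_le (by linarith)]
    rintro x ⟨hx, hx'⟩
    simp only [hf]
    rw [abs_of_nonneg hx, abs_of_nonpos (by linarith), min_eq_left (by linarith)]
    ring_nf
  have f_far : Set.EqOn f (fun x => exp ((3 * t - 1) * x + -(2 * t * m))) (Set.uIcc (m / 2) m) := by
    rw [Set.uIcc_of_le (by linarith)]
    rintro x ⟨hx, hx'⟩
    simp only [hf]
    rw [abs_of_nonneg (by linarith), abs_of_nonpos (by linarith), min_eq_right (by linarith)]
    ring_nf
  have f_right : Set.EqOn f (fun x => exp (2 * t * m) * exp (-(1 + t) * x)) (Set.Ioi m) := by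
    intro x (hx : m < x)
    simp only [hf]
    rw [abs_of_nonneg (by linarith), abs_of_nonneg (by linarith), min_eq_right (by linarith),
      ← exp_add]
    ring_nf
  have int_left : IntegrableOn f (Set.Iic 0) :=
    (integrableOn_exp_mul_Iic ha 0).congr_fun f_left.symm measurableSet_Iic
  have int_right : IntegrableOn f (Set.Ioi m) :=
    IntegrableOn.congr_fun ((integrableOn_exp_mul_Ioi (by linarith) m).const_mul _)
      f_right.symm measurableSet_Ioi
  have int_pos : IntegrableOn f (Set.Ioi 0) := by
    rw [← Set.Ioc_union_Ioi_eq_Ioi hm.le]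
    exact (hcont.integrableOn_Ioc).union int_right
  have split : ∫ x, f x = (∫ x in Set.Iic 0, f x) + ((∫ x in (0)..(m / 2), f x)
      + (∫ x in (m / 2)..m, f x) + ∫ x in Set.Ioi m, f x) := by
    rw [intervalIntegral.integral_add_adjacent_intervals (hcont.intervalIntegrable _ _)
      (hcont.intervalIntegrable _ _), intervalIntegral.integral_interval_add_Ioi int_pos int_right,
      intervalIntegral.integral_Iic_add_Ioi int_left int_pos]
  rw [split, setIntegral_congr_fun measurableSet_Iic f_left, intervalIntegral.integral_congr f_near,
    intervalIntegral.integral_congr f_far, setIntegral_congr_fun measurableSet_Ioi f_right,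
    integral_const_mul, integral_exp_mul_Iic ha, integral_exp_mul_Ioi (by linarith),
    intervalIntegral_exp_mul_add (by linarith), intervalIntegral_exp_mul_add hb]
  have e₁ : exp (-(1 + t) * (m / 2) + 0) = exp (-m * (1 + t) / 2) := by ring_nf
  have e₂ : exp ((3 * t - 1) * (m / 2) + -(2 * t * m)) = exp (-m * (1 + t) / 2) := by ring_nf
  have e₃ : exp ((3 * t - 1) * m + -(2 * t * m)) = exp (-m * (1 - t)) := by ring_nf
  have e₄ : exp (2 * t * m) * (-exp (-(1 + t) * m) / -(1 + t)) =
      exp (-m * (1 - t)) / (1 + t) := by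
    rw [neg_div_neg_eq, ← mul_div_assoc, ← exp_add]
    ring_nf
  rw [e₁, e₂, e₃, e₄, mul_zero, mul_zero, zero_add, exp_zero]
  field_simp
  ring
end
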